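/- Let V : ℝ³ → ℝ be continuously differentiable with V and x·∇V bounded on ℝ³. There is no classical decaying solution u of the focusing cubic NLS with potential, defined for all t ∈ ℝ, satisfying simultaneously: (i) uniform H¹ bound: sup_{t∈ℝ} ∫_{ℝ³}(|u(t,x)|² + |∇ₓu(t,x)|²) dx < ∞; (ii) uniform spatial tightness: for every ε > 0 there exists R > 0 such that ∫_{|x| ≥ R}(|u(t,x)|² + |∇ₓu(t,x)|² + |u(t,x)|⁴) dx ≤ ε for all t ∈ ℝ; and (iii) uniformly positive virial: there exists κ > 0 with K_{V,2}(u(t,·)) ≥ κ for all t ∈ ℝ. -/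

import Mathlib

open MeasureTheory

noncomputable section

abbrev R3 := EuclideanSpace ℝ (Fin 3)

/-- Mass: `M(φ) = (1/2) ∫ |φ|²`. -/
def Mfun {E : Type*} [NormedAddCommGroup E] (φ : R3 → E) : ℝ :=
  (1 / 2) * ∫ x, ‖φ x‖ ^ 2

/-- Kinetic energy: `H₀(φ) = (1/2) ∫ |∇φ|²`. -/
def H0 {E : Type*} [NormedAddCommGroup E] [NormedSpace ℝ E] (φ : R3 → E) : ℝ :=
  (1 / 2) * ∫ x, ‖fderiv ℝ φ x‖ ^ 2

/-- Quartic functional: `G(φ) = (1/4) ∫ |φ|⁴`. -/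
def Gfun {E : Type*} [NormedAddCommGroup E] (φ : R3 → E) : ℝ :=
  (1 / 4) * ∫ x, ‖φ x‖ ^ 4

/-- Free energy: `E₀(φ) = H₀(φ) - G(φ)`. -/
def E0 {E : Type*} [NormedAddCommGroup E] [NormedSpace ℝ E] (φ : R3 → E) : ℝ :=
  H0 φ - Gfun φ

/-- The radial derivative of the potential: `(x·∇V)(x) = ⟨x, ∇V(x)⟩ = (DV(x))(x)`. -/
def xdV (V : R3 → ℝ) (x : R3) : ℝ := fderiv ℝ V x x

/-- Free virial functional: `K₀,₂(φ) = 2H₀(φ) - 3G(φ)`. -/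
def K02 {E : Type*} [NormedAddCommGroup E] [NormedSpace ℝ E] (φ : R3 → E) : ℝ :=
  2 * H0 φ - 3 * Gfun φ

/-- Virial functional with potential:
`K_{V,2}(φ) = 2H₀(φ) - 3G(φ) - (1/2) ∫ (x·∇V) |φ|²`. -/
def K2 {E : Type*} [NormedAddCommGroup E] [NormedSpace ℝ E]
    (V : R3 → ℝ) (φ : R3 → E) : ℝ :=
  2 * H0 φ - 3 * Gfun φ - (1 / 2) * ∫ x, xdV V x * ‖φ x‖ ^ 2

/-- `I_V(φ) = (1/2)G(φ) + (1/4) ∫ ((x·∇V) + 2V) |φ|²`. -/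
def IV {E : Type*} [NormedAddCommGroup E] (V : R3 → ℝ) (φ : R3 → E) : ℝ :=
  (1 / 2) * Gfun φ + (1 / 4) * ∫ x, (xdV V x + 2 * V x) * ‖φ x‖ ^ 2

/-- Energy with potential: `E_V(φ) = H₀(φ) + (1/2)∫ V|φ|² - G(φ)`. -/
def EV {E : Type*} [NormedAddCommGroup E] [NormedSpace ℝ E]
    (V : R3 → ℝ) (φ : R3 → E) : ℝ :=
  H0 φ + (1 / 2) * ∫ x, V x * ‖φ x‖ ^ 2 - Gfun φ

/-- The spatial Laplacian of `φ : ℝ³ → ℂ`. -/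
def lap (φ : R3 → ℂ) (x : R3) : ℂ :=
  ∑ i : Fin 3,
    fderiv ℝ (fun y => fderiv ℝ φ y (EuclideanSpace.single i 1)) x
      (EuclideanSpace.single i 1)

/-- Directional derivative on space-time. -/
def dd {F : Type*} [NormedAddCommGroup F] [NormedSpace ℝ F] (ξ : ℝ × R3) (f : ℝ × R3 → F) :
    ℝ × R3 → F := fun z => fderiv ℝ f z ξ

/-- Standard basis vector. -/
def eb (i : Fin 3) : R3 := EuclideanSpace.single i 1

section calcu
variable {F : Type*} [NormedAddCommGroup F] [NormedSpace ℝ F]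

lemma dd_contDiff {f : ℝ × R3 → F} (hf : ContDiff ℝ (⊤ : ℕ∞) f) (ξ : ℝ × R3) :
    ContDiff ℝ (⊤ : ℕ∞) (dd ξ f) := by
  unfold dd
  exact (hf.fderiv_right (m := (⊤ : ℕ∞)) (by simp)).clm_apply contDiff_const

lemma dd_comm {f : ℝ × R3 → F} (hf : ContDiff ℝ (⊤ : ℕ∞) f) (ξ η : ℝ × R3) :
    dd ξ (dd η f) = dd η (dd ξ f) := by
  funext z
  have hd : DifferentiableAt ℝ (fderiv ℝ f) z :=
    ((hf.fderiv_right (m := (⊤ : ℕ∞)) (by simp)).differentiable (by simp)) z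
  have h : ∀ a b : ℝ × R3, dd a (dd b f) z = fderiv ℝ (fderiv ℝ f) z a b := by
    intro a b
    unfold dd
    have := (hd.hasFDerivAt.clm_apply (hasFDerivAt_const b z)).fderiv
    rw [this]; simp
  rw [h, h]
  have hs : IsSymmSndFDerivAt ℝ f z :=
    (hf.contDiffAt).isSymmSndFDerivAt (by
      rw [minSmoothness_of_isRCLikeNormedField]; exact WithTop.coe_le_coe.2 (le_top : (2:ℕ∞) ≤ ⊤))
  exact hs ξ η

lemma line_deriv {f : ℝ × R3 → F} {t : ℝ} {x e : R3}
    (hf : DifferentiableAt ℝ f (t, x)) :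
    HasDerivAt (fun s : ℝ => f (t, x + s • e)) (dd (0, e) f (t, x)) 0 := by
  have h1 : HasDerivAt (fun s : ℝ => ((t, x + s • e) : ℝ × R3)) ((0, e) : ℝ × R3) 0 := by
    have h2 : HasDerivAt (fun s : ℝ => x + s • e) e 0 := by
      simpa using ((hasDerivAt_id (0:ℝ)).smul_const e).const_add x
    exact (hasDerivAt_const (0:ℝ) t).prodMk h2
  have h3 : HasFDerivAt f (fderiv ℝ f (t, x)) ((t, x + (0:ℝ) • e) : ℝ × R3) := by
    simpa using hf.hasFDerivAt
  exact h3.comp_hasDerivAt (0:ℝ) h1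

lemma time_deriv {f : ℝ × R3 → F} {t : ℝ} {x : R3}
    (hf : DifferentiableAt ℝ f (t, x)) :
    HasDerivAt (fun s : ℝ => f (s, x)) (dd (1, 0) f (t, x)) t := by
  have h1 : HasDerivAt (fun s : ℝ => ((s, x) : ℝ × R3)) ((1, 0) : ℝ × R3) t :=
    (hasDerivAt_id t).prodMk (hasDerivAt_const t x)
  exact hf.hasFDerivAt.comp_hasDerivAt t h1

lemma space_fderiv {f : ℝ × R3 → F} {t : ℝ} {x : R3}
    (hf : DifferentiableAt ℝ f (t, x)) (e : R3) :
    fderiv ℝ (fun y => f (t, y)) x e = dd (0, e) f (t, x) := by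
  have h1 : HasFDerivAt (fun y : R3 => ((t, y) : ℝ × R3)) (ContinuousLinearMap.inr ℝ ℝ R3) x :=
    (hasFDerivAt_prodMk_right t x)
  have := (hf.hasFDerivAt.comp x h1).fderiv
  have h2 : fderiv ℝ (fun y => f (t, y)) x = _ := this
  rw [h2]; simp [dd]

lemma line_deriv' {f : R3 → F} {x e : R3} (hf : DifferentiableAt ℝ f x) :
    HasDerivAt (fun s : ℝ => f (x + s • e)) (fderiv ℝ f x e) 0 := by
  have h2 : HasDerivAt (fun s : ℝ => x + s • e) e 0 := by
    simpa using ((hasDerivAt_id (0:ℝ)).smul_const e).const_add x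
  have h3 : HasFDerivAt f (fderiv ℝ f x) (x + (0:ℝ) • e) := by
    simpa using hf.hasFDerivAt
  exact h3.comp_hasDerivAt (0:ℝ) h2

lemma clm_dd {G : Type*} [NormedAddCommGroup G] [NormedSpace ℝ G] (L : F →L[ℝ] G)
    {f : ℝ × R3 → F} (hf : ContDiff ℝ (⊤ : ℕ∞) f) (ξ : ℝ × R3) (z : ℝ × R3) :
    dd ξ (fun z => L (f z)) z = L (dd ξ f z) := by
  unfold dd
  have := (L.hasFDerivAt.comp z ((hf.differentiable (by simp)) z).hasFDerivAt).fderiv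
  have h2 : fderiv ℝ (fun z => L (f z)) z = _ := this
  rw [h2]; simp

end calcu

lemma integral_div_zero {J : R3 → ℝ} (hJ : ContDiff ℝ 1 J) (hc : HasCompactSupport J) (e : R3) :
    Integrable (fun x => fderiv ℝ J x e) ∧ ∫ x, fderiv ℝ J x e = 0 := by
  have hcont : Continuous (fun x => fderiv ℝ J x e) :=
    (hJ.continuous_fderiv (by simp)).clm_apply continuous_const
  have hi : Integrable (fun x => fderiv ℝ J x e) :=
    hcont.integrable_of_hasCompactSupport (hc.fderiv_apply ℝ e)
  refine ⟨hi, ?_⟩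
  have := integral_mul_fderiv_eq_neg_fderiv_mul_of_integrable (μ := (volume : Measure R3))
    (f := fun _ : R3 => (1:ℝ)) (g := J) (v := e) (by simp) (by simpa using hi)
    (by simpa using hJ.continuous.integrable_of_hasCompactSupport hc)
    (fun x _ => by fun_prop) (fun x _ => (hJ.differentiable (by simp)) x)
  simpa using this

lemma param_integral {f : ℝ × R3 → ℝ} (hf : ContDiff ℝ 1 f) {K : Set R3} (hK : IsCompact K)
    (h0 : ∀ t, ∀ x ∉ K, f (t, x) = 0) (t : ℝ) :
    Integrable (fun x => dd (1, 0) f (t, x)) ∧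
    HasDerivAt (fun s => ∫ x, f (s, x)) (∫ x, dd (1, 0) f (t, x)) t := by
  have hd : Continuous (dd (1, 0) f) :=
    (hf.continuous_fderiv (by simp)).clm_apply continuous_const
  have hderiv : ∀ s x, HasDerivAt (fun s => f (s, x)) (dd (1, 0) f (s, x)) s :=
    fun s x => time_deriv ((hf.differentiable (by simp)) _)
  have h0' : ∀ t, ∀ x ∉ K, dd (1, 0) f (t, x) = 0 := by
    intro t x hx
    have h1 := hderiv t x
    have h2 : (fun s => f (s, x)) = fun _ => (0:ℝ) := by
      funext s; exact h0 s x hx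
    rw [h2] at h1
    exact h1.unique (hasDerivAt_const t (0:ℝ))
  obtain ⟨C, hC⟩ := ((isCompact_Icc (a := t - 1) (b := t + 1)).prod hK).exists_bound_of_continuousOn
    hd.continuousOn
  have hsupp : ∀ s, HasCompactSupport (fun x => f (s, x)) := fun s =>
    HasCompactSupport.intro hK (h0 s)
  refine hasDerivAt_integral_of_dominated_loc_of_deriv_le (μ := (volume : Measure R3))
    (F := fun s x => f (s, x)) (F' := fun s x => dd (1, 0) f (s, x)) (s := Set.Icc (t-1) (t+1))
    (bound := K.indicator (fun _ => C)) (Icc_mem_nhds (by linarith) (by linarith))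
    (Filter.Eventually.of_forall fun s => ?_) ?_ ?_ ?_ ?_ ?_
  · exact (hf.continuous.comp (by fun_prop)).aestronglyMeasurable
  · exact (hf.continuous.comp (by fun_prop : Continuous fun x : R3 => (t, x))).integrable_of_hasCompactSupport (hsupp t)
  · exact (hd.comp (by fun_prop : Continuous fun x : R3 => (t, x))).aestronglyMeasurable
  · refine Filter.Eventually.of_forall fun x s hs => ?_
    by_cases hx : x ∈ K
    · rw [Set.indicator_of_mem hx]; exact hC (s, x) ⟨hs, hx⟩
    · rw [Set.indicator_of_notMem hx, h0' s x hx]; simp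
  · rw [integrable_indicator_iff hK.measurableSet]
    exact integrableOn_const hK.measure_lt_top.ne
  · exact Filter.Eventually.of_forall fun x s _ => hderiv s x

lemma frob_upper (L : R3 →L[ℝ] ℂ) : ‖L‖ ^ 2 ≤ ∑ k, ‖L (eb k)‖ ^ 2 := by
  have h0 : 0 ≤ ∑ k, ‖L (eb k)‖ ^ 2 := Finset.sum_nonneg fun _ _ => sq_nonneg _
  have : ‖L‖ ≤ Real.sqrt (∑ k, ‖L (eb k)‖ ^ 2) := by
    refine L.opNorm_le_bound (Real.sqrt_nonneg _) fun x => ?_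
    have hx : x = ∑ k, x k • eb k := by
      ext i; fin_cases i <;> simp [Fin.sum_univ_three, eb]
    have h1 : L x = ∑ k, x k • L (eb k) := by
      conv_lhs => rw [hx]
      simp
    rw [h1, EuclideanSpace.norm_eq, ← Real.sqrt_mul h0]
    apply Real.le_sqrt_of_sq_le
    calc ‖∑ k, x k • L (eb k)‖ ^ 2 ≤ (∑ k, ‖L (eb k)‖ * ‖x k‖) ^ 2 := by
          gcongr
          refine (norm_sum_le _ _).trans (Finset.sum_le_sum fun k _ => ?_)
          rw [norm_smul, mul_comm]
      _ ≤ _ := Finset.sum_mul_sq_le_sq_mul_sq _ _ _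
  calc ‖L‖ ^ 2 ≤ (Real.sqrt (∑ k, ‖L (eb k)‖ ^ 2)) ^ 2 := by gcongr
    _ = _ := Real.sq_sqrt h0

lemma frob_lower (L : R3 →L[ℝ] ℂ) (k : Fin 3) : ‖L (eb k)‖ ≤ ‖L‖ := by
  have := L.le_opNorm (eb k)
  simpa [eb] using this

/-- Truncated radial vector field. -/
def wa (χ : R3 → ℝ) (k : Fin 3) (x : R3) : ℝ := χ x * x k

/-- Its divergence. -/
def wD (χ : R3 → ℝ) (x : R3) : ℝ := ∑ k, fderiv ℝ (wa χ k) x (eb k)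

lemma wa_contDiff {χ : R3 → ℝ} (h : ContDiff ℝ (⊤ : ℕ∞) χ) (k : Fin 3) :
    ContDiff ℝ (⊤ : ℕ∞) (wa χ k) := by
  unfold wa
  exact h.mul (by fun_prop)

lemma wD_contDiff {χ : R3 → ℝ} (h : ContDiff ℝ (⊤ : ℕ∞) χ) :
    ContDiff ℝ (⊤ : ℕ∞) (wD χ) := by
  unfold wD
  exact ContDiff.sum fun k _ =>
    ((wa_contDiff h k).fderiv_right (m := (⊤ : ℕ∞)) (by simp)).clm_apply contDiff_const

lemma wa_supp {χ : R3 → ℝ} (h : HasCompactSupport χ) (k : Fin 3) :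
    HasCompactSupport (wa χ k) := by
  unfold wa
  exact h.mul_right

lemma wD_supp {χ : R3 → ℝ} (h : HasCompactSupport χ) :
    HasCompactSupport (wD χ) := by
  have h' : ∀ k, HasCompactSupport (fun x => fderiv ℝ (wa χ k) x (eb k)) :=
    fun k => (wa_supp h k).fderiv_apply ℝ _
  have : wD χ = (fun x => fderiv ℝ (wa χ 0) x (eb 0)) + (fun x => fderiv ℝ (wa χ 1) x (eb 1))
      + (fun x => fderiv ℝ (wa χ 2) x (eb 2)) := by
    funext x; simp [wD, Fin.sum_univ_three]
  rw [this]
  exact ((h' 0).add (h' 1)).add (h' 2)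

lemma fderiv_scale {f : R3 → ℝ} (hf : Differentiable ℝ f) (c r : ℝ) (x e : R3) :
    fderiv ℝ (fun x => c * f (r • x)) x e = c * r * fderiv ℝ f (r • x) e := by
  have h1 : HasFDerivAt (fun x : R3 => r • x) (r • ContinuousLinearMap.id ℝ R3) x :=
    (hasFDerivAt_id x).const_smul r
  have h2 := (((hf (r • x)).hasFDerivAt.comp x h1).const_mul c).fderiv
  have h3 : fderiv ℝ (fun x => c * f (r • x)) x = _ := h2
  rw [h3]
  simp [mul_assoc]

lemma exists_weight : ∃ C : ℝ, 0 ≤ C ∧ ∀ R : ℝ, 1 ≤ R → ∃ χ : R3 → ℝ,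
    ContDiff ℝ (⊤ : ℕ∞) χ ∧ HasCompactSupport χ ∧ (∀ x, 0 ≤ χ x ∧ χ x ≤ 1) ∧
    (∀ x, ‖x‖ < R → χ x = 1) ∧
    (∀ k x, |wa χ k x| ≤ C * R) ∧
    (∀ k j x, |fderiv ℝ (wa χ k) x (eb j)| ≤ C) ∧
    (∀ j x, |fderiv ℝ (wD χ) x (eb j)| ≤ C) ∧
    (∀ x, ‖x‖ < R → ∀ k j, fderiv ℝ (wa χ k) x (eb j) = if k = j then 1 else 0) ∧
    (∀ x, ‖x‖ < R → ∀ j, fderiv ℝ (wD χ) x (eb j) = 0) := by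
  let b : ContDiffBump (0 : R3) := ⟨1, 2, by norm_num, by norm_num⟩
  have hb : ContDiff ℝ (⊤ : ℕ∞) b := b.contDiff
  have hbc : HasCompactSupport b := b.hasCompactSupport
  have B : ∀ f : R3 → ℝ, Continuous f → HasCompactSupport f → ∃ C, 0 ≤ C ∧ ∀ x, |f x| ≤ C := by
    intro f hf hc
    obtain ⟨C, hC⟩ := hf.bounded_above_of_compact_support hc
    exact ⟨C, (norm_nonneg _).trans (hC 0), hC⟩
  have B1 : ∀ k, ∃ C, 0 ≤ C ∧ ∀ x, |wa b k x| ≤ C := fun k =>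
    B _ (wa_contDiff hb k).continuous (wa_supp hbc k)
  have B2 : ∀ k j, ∃ C, 0 ≤ C ∧ ∀ x, |fderiv ℝ (wa b k) x (eb j)| ≤ C := fun k j =>
    B _ (((wa_contDiff hb k).continuous_fderiv (by simp)).clm_apply continuous_const)
      ((wa_supp hbc k).fderiv_apply ℝ _)
  have B3 : ∀ j, ∃ C, 0 ≤ C ∧ ∀ x, |fderiv ℝ (wD b) x (eb j)| ≤ C := fun j =>
    B _ (((wD_contDiff hb).continuous_fderiv (by simp)).clm_apply continuous_const)
      ((wD_supp hbc).fderiv_apply ℝ _)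
  choose c1 h1 h1' using B1
  choose c2 h2 h2' using B2
  choose c3 h3 h3' using B3
  have s1 : 0 ≤ ∑ k, c1 k := Finset.sum_nonneg fun k _ => h1 k
  have s2 : 0 ≤ ∑ k, ∑ j, c2 k j := Finset.sum_nonneg fun k _ => Finset.sum_nonneg fun j _ => h2 k j
  have s3 : 0 ≤ ∑ k, c3 k := Finset.sum_nonneg fun k _ => h3 k
  refine ⟨∑ k, c1 k + ∑ k, ∑ j, c2 k j + ∑ k, c3 k, by positivity, fun R hR => ?_⟩
  have hR0 : 0 < R := by linarith
  have e1 : ∀ k, wa (fun x => b (R⁻¹ • x)) k = fun x => R * wa b k (R⁻¹ • x) := by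
    intro k; funext x; simp [wa]; field_simp
  have e2 : ∀ k j x, fderiv ℝ (wa (fun x => b (R⁻¹ • x)) k) x (eb j)
      = fderiv ℝ (wa b k) (R⁻¹ • x) (eb j) := by
    intro k j x
    rw [e1, fderiv_scale ((wa_contDiff hb k).differentiable (by simp)), mul_inv_cancel₀ hR0.ne',
      one_mul]
  have e3 : wD (fun x => b (R⁻¹ • x)) = fun x => 1 * wD b (R⁻¹ • x) := by
    funext x; simp [wD, e2]
  have e4 : ∀ j x, fderiv ℝ (wD (fun x => b (R⁻¹ • x))) x (eb j)
      = R⁻¹ * fderiv ℝ (wD b) (R⁻¹ • x) (eb j) := by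
    intro j x
    rw [e3, fderiv_scale ((wD_contDiff hb).differentiable (by simp)), one_mul]
  have hχ : ContDiff ℝ (⊤ : ℕ∞) (fun x : R3 => b (R⁻¹ • x)) :=
    hb.comp (contDiff_const_smul _)
  have hone : ∀ x : R3, ‖x‖ < R → b (R⁻¹ • x) = 1 := by
    intro x hx
    apply b.one_of_mem_closedBall
    simp only [Metric.mem_closedBall, dist_zero_right, norm_smul, norm_inv, Real.norm_eq_abs,
      abs_of_pos hR0]
    change R⁻¹ * ‖x‖ ≤ 1
    rw [inv_mul_le_iff₀ hR0]; linarith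
  have hin : ∀ x : R3, ‖x‖ < R → ∀ k j, fderiv ℝ (wa (fun x => b (R⁻¹ • x)) k) x (eb j)
      = if k = j then 1 else 0 := by
    intro x hx k j
    have hev : wa (fun x => b (R⁻¹ • x)) k =ᶠ[nhds x] fun y => (EuclideanSpace.proj k : R3 →L[ℝ] ℝ) y := by
      have : {y : R3 | ‖y‖ < R} ∈ nhds x := (isOpen_lt continuous_norm continuous_const).mem_nhds hx
      filter_upwards [this] with y hy
      simp [wa, hone y hy]
    rw [hev.fderiv_eq, ContinuousLinearMap.fderiv]
    simp [eb]
  refine ⟨fun x => b (R⁻¹ • x), hχ, ?_, fun x => ⟨b.nonneg, b.le_one⟩, hone, ?_, ?_, ?_, hin, ?_⟩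
  · exact hbc.comp_homeomorph (Homeomorph.smulOfNeZero (α := R3) R⁻¹ (inv_ne_zero hR0.ne'))
  · intro k x
    rw [e1, abs_mul, abs_of_pos hR0, mul_comm]
    gcongr
    have := Finset.single_le_sum (f := c1) (fun k _ => h1 k) (Finset.mem_univ k)
    linarith [h1' k (R⁻¹ • x)]
  · intro k j x
    rw [e2]
    have a1 := Finset.single_le_sum (f := c2 k) (fun j _ => h2 k j) (Finset.mem_univ j)
    have a2 := Finset.single_le_sum (f := fun k => ∑ j, c2 k j)
      (fun k _ => Finset.sum_nonneg fun j _ => h2 k j) (Finset.mem_univ k)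
    have a3 := h2' k j (R⁻¹ • x)
    linarith
  · intro j x
    rw [e4, abs_mul, abs_of_pos (inv_pos.2 hR0)]
    have a1 := Finset.single_le_sum (f := c3) (fun k _ => h3 k) (Finset.mem_univ j)
    have a3 := h3' j (R⁻¹ • x)
    have : R⁻¹ * |fderiv ℝ (wD b) (R⁻¹ • x) (eb j)| ≤ 1 * |fderiv ℝ (wD b) (R⁻¹ • x) (eb j)| := by
      gcongr; exact inv_le_one_of_one_le₀ hR
    linarith
  · intro x hx j
    have hev : wD (fun x => b (R⁻¹ • x)) =ᶠ[nhds x] fun y => (3:ℝ) := by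
      have : {y : R3 | ‖y‖ < R} ∈ nhds x := (isOpen_lt continuous_norm continuous_const).mem_nhds hx
      filter_upwards [this] with y hy
      simp [wD, hin y hy]
    rw [hev.fderiv_eq]; simp

/-- The flux of the momentum density. -/
def Jf (j : Fin 3) (a p q : Fin 3 → ℝ) (v w vt wt D V : ℝ) : ℝ :=
  a j * (v * wt - w * vt) + 2 * ∑ k, a k * (p k * p j + q k * q j)
    - a j * ∑ k, (p k ^ 2 + q k ^ 2) + D * (v * p j + w * q j)
    - a j * V * (v ^ 2 + w ^ 2) + 1 / 2 * (a j * (v ^ 2 + w ^ 2) ^ 2)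

/-- Formal derivative of the flux in direction `j`. -/
def dJf (j : Fin 3) (a p q : Fin 3 → ℝ) (v w vt wt D V : ℝ)
    (a' p' q' : Fin 3 → ℝ) (vt' wt' D' V' : ℝ) : ℝ :=
  a' j * (v * wt - w * vt) + a j * (p j * wt + v * wt' - q j * vt - w * vt')
    + 2 * ∑ k, (a' k * (p k * p j + q k * q j)
      + a k * (p' k * p j + p k * p' j + q' k * q j + q k * q' j))
    - (a' j * ∑ k, (p k ^ 2 + q k ^ 2) + a j * ∑ k, (2 * p k * p' k + 2 * q k * q' k))
    + (D' * (v * p j + w * q j) + D * (p j * p j + v * p' j + q j * q j + w * q' j))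
    - (a' j * V * (v ^ 2 + w ^ 2) + a j * V' * (v ^ 2 + w ^ 2)
      + a j * V * (2 * v * p j + 2 * w * q j))
    + 1 / 2 * (a' j * (v ^ 2 + w ^ 2) ^ 2
      + a j * (2 * (v ^ 2 + w ^ 2) * (2 * v * p j + 2 * w * q j)))

/-- The virial density. -/
def Phi (a : Fin 3 → ℝ) (a' : Fin 3 → Fin 3 → ℝ) (D' V' p q : Fin 3 → ℝ) (v w : ℝ) : ℝ :=
  -2 * ∑ k, ∑ j, a' k j * (p k * p j + q k * q j) - ∑ j, D' j * (v * p j + w * q j)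
    + (∑ j, a j * V' j) * (v ^ 2 + w ^ 2) + 1 / 2 * (∑ k, a' k k) * (v ^ 2 + w ^ 2) ^ 2

lemma Jf_hasDerivAt (j : Fin 3) (a p q : Fin 3 → ℝ → ℝ) (v w vt wt D V : ℝ → ℝ)
    (a' p' q' : Fin 3 → ℝ) (vt' wt' D' V' : ℝ)
    (ha : ∀ k, HasDerivAt (a k) (a' k) 0) (hp : ∀ k, HasDerivAt (p k) (p' k) 0)
    (hq : ∀ k, HasDerivAt (q k) (q' k) 0)
    (hv : HasDerivAt v (p j 0) 0) (hw : HasDerivAt w (q j 0) 0)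
    (hvt : HasDerivAt vt vt' 0) (hwt : HasDerivAt wt wt' 0)
    (hD : HasDerivAt D D' 0) (hV : HasDerivAt V V' 0) :
    HasDerivAt (fun s => Jf j (fun k => a k s) (fun k => p k s) (fun k => q k s)
        (v s) (w s) (vt s) (wt s) (D s) (V s))
      (dJf j (fun k => a k 0) (fun k => p k 0) (fun k => q k 0)
        (v 0) (w 0) (vt 0) (wt 0) (D 0) (V 0) a' p' q' vt' wt' D' V') 0 := by
  unfold Jf dJf
  have hvw := (hv.fun_pow 2).fun_add (hw.fun_pow 2)
  have t1 := (ha j).fun_mul ((hv.fun_mul hwt).fun_sub (hw.fun_mul hvt))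
  have t2 : ∀ k, HasDerivAt (fun s => a k s * (p k s * p j s + q k s * q j s)) _ 0 := fun k =>
    (ha k).fun_mul (((hp k).fun_mul (hp j)).fun_add ((hq k).fun_mul (hq j)))
  have t2' := (HasDerivAt.fun_sum (u := Finset.univ) fun k _ => t2 k).const_mul 2
  have t3 : ∀ k, HasDerivAt (fun s => p k s ^ 2 + q k s ^ 2) _ 0 := fun k =>
    ((hp k).fun_pow 2).fun_add ((hq k).fun_pow 2)
  have t3' := (ha j).fun_mul (HasDerivAt.fun_sum (u := Finset.univ) fun k _ => t3 k)
  have t4 := hD.fun_mul ((hv.fun_mul (hp j)).fun_add (hw.fun_mul (hq j)))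
  have t5 := ((ha j).fun_mul hV).fun_mul hvw
  have t6 := ((ha j).fun_mul (hvw.fun_pow 2)).const_mul (1/2)
  refine (((((t1.fun_add t2').fun_sub t3').fun_add t4).fun_sub t5).fun_add t6).congr_deriv ?_
  simp only [Fin.sum_univ_three]
  push_cast
  ring

lemma alg_identity (a p q vt' wt' D' V' : Fin 3 → ℝ) (a' p' q' : Fin 3 → Fin 3 → ℝ)
    (v w vt wt V : ℝ)
    (hp : ∀ k j, p' k j = p' j k) (hq : ∀ k j, q' k j = q' j k)
    (hvt : vt = ∑ k, q' k k - V * w + (v ^ 2 + w ^ 2) * w)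
    (hwt : wt = -(∑ k, p' k k - V * v + (v ^ 2 + w ^ 2) * v)) :
    ∑ k, a k * (vt * q k + v * wt' k - (wt * p k + w * vt' k)) =
      Phi a a' D' V' p q v w + ∑ j, dJf j a p q v w vt wt (∑ k, a' k k) V
        (fun k => a' k j) (fun k => p' k j) (fun k => q' k j) (vt' j) (wt' j) (D' j) (V' j) := by
  unfold Phi dJf
  have h1 := hp 1 0
  have h2 := hp 2 0
  have h3 := hp 2 1
  have h4 := hq 1 0
  have h5 := hq 2 0
  have h6 := hq 2 1
  simp only [Fin.sum_univ_three] at *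
  rw [h1, h2, h3, h4, h5, h6, hvt, hwt]
  ring

lemma Jf_contDiff (j : Fin 3) (a p q : Fin 3 → R3 → ℝ) (v w vt wt D V : R3 → ℝ)
    (ha : ∀ k, ContDiff ℝ 1 (a k)) (hp : ∀ k, ContDiff ℝ 1 (p k)) (hq : ∀ k, ContDiff ℝ 1 (q k))
    (hv : ContDiff ℝ 1 v) (hw : ContDiff ℝ 1 w) (hvt : ContDiff ℝ 1 vt) (hwt : ContDiff ℝ 1 wt)
    (hD : ContDiff ℝ 1 D) (hV : ContDiff ℝ 1 V) :
    ContDiff ℝ 1 (fun s => Jf j (fun k => a k s) (fun k => p k s) (fun k => q k s)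
        (v s) (w s) (vt s) (wt s) (D s) (V s)) := by
  unfold Jf
  simp only [Fin.sum_univ_three]
  fun_prop

/-- Localized momentum density. -/
def mm (χ : R3 → ℝ) (v w : ℝ × R3 → ℝ) (z : ℝ × R3) : ℝ :=
  ∑ k, wa χ k z.2 * (v z * dd (0, eb k) w z - w z * dd (0, eb k) v z)

/-- Virial density along the flow. -/
def PhiF (χ V : R3 → ℝ) (v w : ℝ × R3 → ℝ) (t : ℝ) (x : R3) : ℝ :=
  Phi (fun k => wa χ k x) (fun k j => fderiv ℝ (wa χ k) x (eb j))
    (fun j => fderiv ℝ (wD χ) x (eb j)) (fun j => fderiv ℝ V x (eb j))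
    (fun k => dd (0, eb k) v (t, x)) (fun k => dd (0, eb k) w (t, x)) (v (t, x)) (w (t, x))

lemma virial_identity {χ V : R3 → ℝ} (hχ : ContDiff ℝ (⊤ : ℕ∞) χ) (hχc : HasCompactSupport χ)
    (hV : ContDiff ℝ 1 V) {v w : ℝ × R3 → ℝ} (hv : ContDiff ℝ (⊤ : ℕ∞) v)
    (hw : ContDiff ℝ (⊤ : ℕ∞) w)
    (hvt : ∀ z, dd (1, 0) v z = ∑ k, dd (0, eb k) (dd (0, eb k) w) z - V z.2 * w z
      + (v z ^ 2 + w z ^ 2) * w z)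
    (hwt : ∀ z, dd (1, 0) w z = -(∑ k, dd (0, eb k) (dd (0, eb k) v) z - V z.2 * v z
      + (v z ^ 2 + w z ^ 2) * v z)) (t : ℝ) :
    Integrable (PhiF χ V v w t) ∧
    HasDerivAt (fun s => ∫ x, mm χ v w (s, x)) (∫ x, PhiF χ V v w t x) t := by
  have hle : (1 : WithTop ℕ∞) ≤ ((⊤ : ℕ∞) : WithTop ℕ∞) :=
    WithTop.coe_le_coe.2 (le_top : (1:ℕ∞) ≤ ⊤)
  have hvk := fun k => dd_contDiff hv (0, eb k)
  have hwk := fun k => dd_contDiff hw (0, eb k)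
  have hvT := dd_contDiff hv (1, 0)
  have hwT := dd_contDiff hw (1, 0)
  have hwa := fun k => wa_contDiff hχ k
  have hwD := wD_contDiff hχ
  have dif : ∀ {f : ℝ × R3 → ℝ}, ContDiff ℝ (⊤ : ℕ∞) f → ∀ z, DifferentiableAt ℝ f z :=
    fun hf z => (hf.differentiable (by simp)) z
  have hmm : ContDiff ℝ 1 (mm χ v w) := by
    unfold mm
    refine ContDiff.sum fun k _ => ?_
    exact (((hwa k).of_le hle).comp contDiff_snd).mul
      (((hv.of_le hle).mul ((hwk k).of_le hle)).sub ((hw.of_le hle).mul ((hvk k).of_le hle)))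
  have hsl : ∀ {f : ℝ × R3 → ℝ}, ContDiff ℝ (⊤ : ℕ∞) f → ContDiff ℝ 1 (fun x : R3 => f (t, x)) :=
    fun hf => (hf.of_le hle).comp (contDiff_prodMk_right t)
  obtain ⟨hmint, hder⟩ := param_integral hmm (K := tsupport χ) hχc (fun s x hx => by
    simp [mm, wa, image_eq_zero_of_notMem_tsupport hx]) t
  let J : Fin 3 → R3 → ℝ := fun j x => Jf j (fun k => wa χ k x) (fun k => dd (0, eb k) v (t, x))
    (fun k => dd (0, eb k) w (t, x)) (v (t, x)) (w (t, x)) (dd (1, 0) v (t, x))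
    (dd (1, 0) w (t, x)) (wD χ x) (V x)
  have hJ : ∀ j, ContDiff ℝ 1 (J j) := fun j =>
    Jf_contDiff j (wa χ) (fun k x => dd (0, eb k) v (t, x)) (fun k x => dd (0, eb k) w (t, x))
      (fun x => v (t, x)) (fun x => w (t, x)) (fun x => dd (1, 0) v (t, x))
      (fun x => dd (1, 0) w (t, x)) (wD χ) V (fun k => (hwa k).of_le hle)
      (fun k => hsl (hvk k)) (fun k => hsl (hwk k)) (hsl hv) (hsl hw) (hsl hvT) (hsl hwT)
      (hwD.of_le hle) hV
  have hJc : ∀ j, HasCompactSupport (J j) := by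
    intro j
    refine HasCompactSupport.intro (K := tsupport χ ∪ tsupport (wD χ))
      (hχc.isCompact.union (wD_supp hχc).isCompact) fun x hx => ?_
    rw [Set.mem_union, not_or] at hx
    simp [J, Jf, wa, image_eq_zero_of_notMem_tsupport hx.1, image_eq_zero_of_notMem_tsupport hx.2]
  have key : ∀ x, dd (1, 0) (mm χ v w) (t, x)
      = PhiF χ V v w t x + ∑ j, fderiv ℝ (J j) x (eb j) := by
    intro x
    have e1 : dd (1, 0) (mm χ v w) (t, x) = ∑ k, wa χ k x *
        (dd (1, 0) v (t, x) * dd (0, eb k) w (t, x) + v (t, x) * dd (0, eb k) (dd (1, 0) w) (t, x)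
        - (dd (1, 0) w (t, x) * dd (0, eb k) v (t, x)
          + w (t, x) * dd (0, eb k) (dd (1, 0) v) (t, x))) := by
      refine (time_deriv ((hmm.differentiable (by simp)) (t, x))).unique ?_
      unfold mm
      refine HasDerivAt.fun_sum fun k _ => ?_
      rw [dd_comm hw, dd_comm hv (0, eb k)]
      exact (((time_deriv (dif hv (t, x))).fun_mul (time_deriv (dif (hwk k) (t, x)))).fun_sub
        ((time_deriv (dif hw (t, x))).fun_mul (time_deriv (dif (hvk k) (t, x))))).const_mul
          (wa χ k x)
    have e2 : ∀ j, fderiv ℝ (J j) x (eb j) = dJf j (fun k => wa χ k x)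
        (fun k => dd (0, eb k) v (t, x))
        (fun k => dd (0, eb k) w (t, x)) (v (t, x)) (w (t, x)) (dd (1, 0) v (t, x))
        (dd (1, 0) w (t, x)) (wD χ x) (V x) (fun k => fderiv ℝ (wa χ k) x (eb j))
        (fun k => dd (0, eb j) (dd (0, eb k) v) (t, x))
        (fun k => dd (0, eb j) (dd (0, eb k) w) (t, x))
        (dd (0, eb j) (dd (1, 0) v) (t, x)) (dd (0, eb j) (dd (1, 0) w) (t, x))
        (fderiv ℝ (wD χ) x (eb j)) (fderiv ℝ V x (eb j)) := by
      intro j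
      refine (line_deriv' ((hJ j).differentiable (by simp) x)).unique ?_
      have := Jf_hasDerivAt j (fun k s => wa χ k (x + s • eb j))
        (fun k s => dd (0, eb k) v (t, x + s • eb j)) (fun k s => dd (0, eb k) w (t, x + s • eb j))
        (fun s => v (t, x + s • eb j)) (fun s => w (t, x + s • eb j))
        (fun s => dd (1, 0) v (t, x + s • eb j)) (fun s => dd (1, 0) w (t, x + s • eb j))
        (fun s => wD χ (x + s • eb j)) (fun s => V (x + s • eb j)) _ _ _ _ _ _ _
        (fun k => line_deriv' ((hwa k).differentiable (by simp) x))
        (fun k => line_deriv (dif (hvk k) _)) (fun k => line_deriv (dif (hwk k) _))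
        (by simpa using line_deriv (dif hv (t, x))) (by simpa using line_deriv (dif hw (t, x)))
        (line_deriv (dif hvT _)) (line_deriv (dif hwT _))
        (line_deriv' (hwD.differentiable (by simp) x)) (line_deriv' (hV.differentiable (by simp) x))
      simpa using this
    rw [e1]
    simp only [e2]
    exact alg_identity _ _ _ _ _ _ _ (fun k j => fderiv ℝ (wa χ k) x (eb j))
      (fun k j => dd (0, eb j) (dd (0, eb k) v) (t, x))
      (fun k j => dd (0, eb j) (dd (0, eb k) w) (t, x)) _ _ _ _ _
      (fun k j => congrFun (dd_comm hv _ _) _) (fun k j => congrFun (dd_comm hw _ _) _)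
      (hvt (t, x)) (hwt (t, x))
  have hdiv := fun j => integral_div_zero (hJ j) (hJc j) (eb j)
  have hsum : Integrable (fun x => ∑ j, fderiv ℝ (J j) x (eb j)) :=
    integrable_finsetSum _ fun j _ => (hdiv j).1
  have hPhi : PhiF χ V v w t = fun x => dd (1, 0) (mm χ v w) (t, x)
      - ∑ j, fderiv ℝ (J j) x (eb j) := by
    funext x; rw [key]; ring
  refine ⟨by rw [hPhi]; exact hmint.sub hsum, ?_⟩
  have : ∫ x, PhiF χ V v w t x = ∫ x, dd (1, 0) (mm χ v w) (t, x) := by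
    rw [hPhi, integral_sub hmint hsum, integral_finsetSum _ fun j _ => (hdiv j).1]
    simp [(hdiv _).2]
  rw [this]; exact hder

lemma Phi_in {a : Fin 3 → ℝ} {a' : Fin 3 → Fin 3 → ℝ} {D' V' p q : Fin 3 → ℝ} {v w X : ℝ}
    (ha' : ∀ k j, a' k j = if k = j then 1 else 0) (hD : ∀ j, D' j = 0)
    (hX : ∑ j, a j * V' j = X) :
    Phi a a' D' V' p q v w = -2 * ∑ k, (p k ^ 2 + q k ^ 2) + X * (v ^ 2 + w ^ 2)
      + 3 / 2 * (v ^ 2 + w ^ 2) ^ 2 := by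
  unfold Phi
  rw [hX]
  simp [ha', hD, Fin.sum_univ_three]
  ring

lemma Phi_out {a : Fin 3 → ℝ} {a' : Fin 3 → Fin 3 → ℝ} {D' V' p q : Fin 3 → ℝ} {v w C c n N : ℝ}
    (hC : 0 ≤ C) (hn : 0 ≤ n) (hN : 0 ≤ N)
    (ha' : ∀ k j, |a' k j| ≤ C) (hD : ∀ j, |D' j| ≤ C) (hX : |∑ j, a j * V' j| ≤ c)
    (hp : ∀ k, |p k| ≤ N) (hq : ∀ k, |q k| ≤ N) (hv : |v| ≤ n) (hw : |w| ≤ n)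
    (hvw : v ^ 2 + w ^ 2 = n ^ 2) :
    Phi a a' D' V' p q v w ≤ 36 * C * N ^ 2 + 3 * C * (n ^ 2 + N ^ 2) + c * n ^ 2
      + 3 / 2 * C * n ^ 4 := by
  have b1 : ∀ k j, -(a' k j * (p k * p j + q k * q j)) ≤ C * (2 * N ^ 2) := by
    intro k j
    refine (neg_le_abs _).trans ?_
    rw [abs_mul]
    refine mul_le_mul (ha' k j) ?_ (abs_nonneg _) hC
    refine (abs_add_le _ _).trans ?_
    rw [abs_mul, abs_mul]
    have h1 := mul_le_mul (hp k) (hp j) (abs_nonneg _) hN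
    have h2 := mul_le_mul (hq k) (hq j) (abs_nonneg _) hN
    nlinarith
  have b2 : ∀ j, -(D' j * (v * p j + w * q j)) ≤ C * (n ^ 2 + N ^ 2) := by
    intro j
    refine (neg_le_abs _).trans ?_
    rw [abs_mul]
    refine mul_le_mul (hD j) ?_ (abs_nonneg _) hC
    refine (abs_add_le _ _).trans ?_
    rw [abs_mul, abs_mul]
    have h1 := mul_le_mul hv (hp j) (abs_nonneg _) hn
    have h2 := mul_le_mul hw (hq j) (abs_nonneg _) hn
    nlinarith [sq_nonneg (n - N)]
  have b3 : (∑ j, a j * V' j) * n ^ 2 ≤ c * n ^ 2 := by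
    gcongr; exact (le_abs_self _).trans hX
  have b4 : ∀ k, a' k k * n ^ 4 ≤ C * n ^ 4 := fun k => by
    gcongr; exact (le_abs_self _).trans (ha' k k)
  unfold Phi
  rw [hvw]
  simp only [Fin.sum_univ_three] at *
  have e : (n ^ 2) ^ 2 = n ^ 4 := by ring
  rw [e]
  have := b1 0 0
  have := b1 0 1
  have := b1 0 2
  have := b1 1 0
  have := b1 1 1
  have := b1 1 2
  have := b1 2 0
  have := b1 2 1
  have := b1 2 2
  have := b2 0
  have := b2 1
  have := b2 2
  have := b4 0
  have := b4 1
  have := b4 2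
  linarith

/-- Localized virial rigidity: there is no global classical decaying solution of the
focusing cubic NLS with potential which is uniformly bounded in `H¹`, uniformly
spatially tight, and has uniformly positive virial functional. -/
theorem stmt5 (V : R3 → ℝ) (hV : ContDiff ℝ 1 V)
    (hVbd : ∃ C, ∀ x, |V x| ≤ C) (hxdVbd : ∃ C, ∀ x, |xdV V x| ≤ C)
    (u : ℝ → R3 → ℂ)
    (hsmooth : ContDiff ℝ (⊤ : ℕ∞) (Function.uncurry u))
    (heq : ∀ (t : ℝ) (x : R3),
      Complex.I * deriv (fun s => u s x) t - lap (u t) x + (V x : ℂ) * u t x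
        = ((‖u t x‖ : ℂ) ^ 2) * u t x)
    (hdecay : ∀ (k n : ℕ) (T : ℝ), ∃ C, ∀ t ∈ Set.Icc (-T) T, ∀ x : R3,
      ‖x‖ ^ k * ‖iteratedFDeriv ℝ n (u t) x‖ ≤ C)
    (hH1 : ∃ B, ∀ t : ℝ,
      (∫ x, (‖u t x‖ ^ 2 + ‖fderiv ℝ (u t) x‖ ^ 2)) ≤ B)
    (htight : ∀ ε > (0 : ℝ), ∃ R > (0 : ℝ), ∀ t : ℝ,
      (∫ x in {x : R3 | R ≤ ‖x‖},
        (‖u t x‖ ^ 2 + ‖fderiv ℝ (u t) x‖ ^ 2 + ‖u t x‖ ^ 4)) ≤ ε)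
    (κ : ℝ) (hκ : 0 < κ) (hvir : ∀ t : ℝ, κ ≤ K2 V (u t)) :
    False := by
  obtain ⟨cV, hcV⟩ := hxdVbd
  obtain ⟨B, hB⟩ := hH1
  obtain ⟨C, hC, hweight⟩ := exists_weight
  have hcV0 : 0 ≤ cV := (abs_nonneg _).trans (hcV 0)
  -- integrability
  have hut : ∀ t, ContDiff ℝ (⊤ : ℕ∞) (u t) := fun t =>
    hsmooth.comp (contDiff_prodMk_right t)
  let S : ℝ → SchwartzMap R3 ℂ := fun t => ⟨u t, hut t, fun k n => by
    obtain ⟨c, hc⟩ := hdecay k n |t|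
    exact ⟨c, fun x => hc t ⟨neg_abs_le t, le_abs_self t⟩ x⟩⟩
  have i2 : ∀ t, Integrable (fun x => ‖u t x‖ ^ 2) := fun t =>
    ((S t).memLp (2 : ℕ)).integrable_norm_pow (by norm_num)
  have i4 : ∀ t, Integrable (fun x => ‖u t x‖ ^ 4) := fun t =>
    ((S t).memLp (4 : ℕ)).integrable_norm_pow (by norm_num)
  have id2 : ∀ t, Integrable (fun x => ‖fderiv ℝ (u t) x‖ ^ 2) := fun t => by
    have h := ((SchwartzMap.fderivCLM ℝ R3 ℂ (S t)).memLp (2 : ℕ)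
      (volume : Measure R3)).integrable_norm_pow (by norm_num)
    exact h
  have hxc : Continuous (xdV V) := by
    unfold xdV
    exact (hV.continuous_fderiv (by simp)).clm_apply continuous_id
  have iV : ∀ t, Integrable (fun x => xdV V x * ‖u t x‖ ^ 2) := fun t =>
    (i2 t).bdd_mul (c := cV) hxc.aestronglyMeasurable (Filter.Eventually.of_forall hcV)
  -- real and imaginary parts
  let U : ℝ × R3 → ℂ := Function.uncurry u
  have hU : ContDiff ℝ (⊤ : ℕ∞) U := hsmooth
  have hUd : ∀ ξ, ContDiff ℝ (⊤ : ℕ∞) (dd ξ U) := fun ξ => dd_contDiff hU ξ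
  let v : ℝ × R3 → ℝ := fun z => Complex.reCLM (U z)
  let w : ℝ × R3 → ℝ := fun z => Complex.imCLM (U z)
  have hv : ContDiff ℝ (⊤ : ℕ∞) v := Complex.reCLM.contDiff.comp hU
  have hw : ContDiff ℝ (⊤ : ℕ∞) w := Complex.imCLM.contDiff.comp hU
  have dv : ∀ ξ z, dd ξ v z = (dd ξ U z).re := fun ξ z => clm_dd Complex.reCLM hU ξ z
  have dw : ∀ ξ z, dd ξ w z = (dd ξ U z).im := fun ξ z => clm_dd Complex.imCLM hU ξ z
  have ddv : ∀ ξ z, dd ξ (dd ξ v) z = (dd ξ (dd ξ U) z).re := fun ξ z => by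
    rw [show dd ξ v = fun z => Complex.reCLM (dd ξ U z) from funext fun z => dv ξ z]
    exact clm_dd Complex.reCLM (hUd ξ) ξ z
  have ddw : ∀ ξ z, dd ξ (dd ξ w) z = (dd ξ (dd ξ U) z).im := fun ξ z => by
    rw [show dd ξ w = fun z => Complex.imCLM (dd ξ U z) from funext fun z => dw ξ z]
    exact clm_dd Complex.imCLM (hUd ξ) ξ z
  have difU : ∀ z, DifferentiableAt ℝ U z := fun z => hU.differentiable (by simp) z
  have hgrad : ∀ t x e, fderiv ℝ (u t) x e = dd (0, e) U (t, x) := fun t x e =>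
    space_fderiv (difU (t, x)) e
  have hlap : ∀ t x, lap (u t) x = ∑ k, dd (0, eb k) (dd (0, eb k) U) (t, x) := by
    intro t x
    unfold lap
    refine Finset.sum_congr rfl fun k _ => ?_
    have : (fun y => fderiv ℝ (u t) y (EuclideanSpace.single k 1))
        = fun y => dd (0, eb k) U (t, y) := funext fun y => hgrad t y _
    rw [this]
    exact space_fderiv ((hUd (0, eb k)).differentiable (by simp) (t, x)) _
  have htime : ∀ t x, deriv (fun s => u s x) t = dd (1, 0) U (t, x) := fun t x =>
    (time_deriv (difU (t, x))).deriv
  have hn2 : ∀ t x, v (t, x) ^ 2 + w (t, x) ^ 2 = ‖u t x‖ ^ 2 := fun t x => by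
    rw [Complex.sq_norm, Complex.normSq_apply]
    simp only [v, w, U, Function.uncurry_apply_pair, Complex.reCLM_apply, Complex.imCLM_apply]
    ring
  have heq' : ∀ t x, Complex.I * dd (1, 0) U (t, x) - ∑ k, dd (0, eb k) (dd (0, eb k) U) (t, x)
      + (V x : ℂ) * U (t, x) = ((v (t, x) ^ 2 + w (t, x) ^ 2 : ℝ) : ℂ) * U (t, x) := by
    intro t x
    rw [hn2, ← htime, ← hlap]
    have := heq t x
    push_cast
    exact this
  have hvt : ∀ z, dd (1, 0) v z = ∑ k, dd (0, eb k) (dd (0, eb k) w) z - V z.2 * w z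
      + (v z ^ 2 + w z ^ 2) * w z := by
    rintro ⟨t, x⟩
    have := congrArg Complex.im (heq' t x)
    simp only [dv, ddw]
    simp only [Complex.add_im, Complex.sub_im, Complex.mul_im, Complex.I_re, Complex.I_im,
      Complex.ofReal_re, Complex.ofReal_im, Complex.im_sum] at this
    change _ - _ + (V x * w (t, x) + _) = _ * w (t, x) + _ at this
    linarith
  have hwt : ∀ z, dd (1, 0) w z = -(∑ k, dd (0, eb k) (dd (0, eb k) v) z - V z.2 * v z
      + (v z ^ 2 + w z ^ 2) * v z) := by
    rintro ⟨t, x⟩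
    have := congrArg Complex.re (heq' t x)
    simp only [dw, ddv]
    simp only [Complex.add_re, Complex.sub_re, Complex.mul_re, Complex.I_re, Complex.I_im,
      Complex.ofReal_re, Complex.ofReal_im, Complex.re_sum] at this
    change _ - _ + (V x * v (t, x) - _) = _ * v (t, x) - _ at this
    linarith
  have hpq : ∀ t x k, dd (0, eb k) v (t, x) ^ 2 + dd (0, eb k) w (t, x) ^ 2
      = ‖fderiv ℝ (u t) x (eb k)‖ ^ 2 := fun t x k => by
    rw [dv, dw, hgrad, Complex.sq_norm, Complex.normSq_apply]; ring
  have hvn : ∀ t x, |v (t, x)| ≤ ‖u t x‖ := fun t x => Complex.abs_re_le_norm _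
  have hwn : ∀ t x, |w (t, x)| ≤ ‖u t x‖ := fun t x => Complex.abs_im_le_norm _
  have hpn : ∀ t x k, |dd (0, eb k) v (t, x)| ≤ ‖fderiv ℝ (u t) x‖ := fun t x k => by
    refine le_trans ?_ (frob_lower _ k)
    rw [dv, hgrad]; exact Complex.abs_re_le_norm _
  have hqn : ∀ t x k, |dd (0, eb k) w (t, x)| ≤ ‖fderiv ℝ (u t) x‖ := fun t x k => by
    refine le_trans ?_ (frob_lower _ k)
    rw [dw, hgrad]; exact Complex.abs_im_le_norm _
  -- choice of the radius
  obtain ⟨C', hC'⟩ : ∃ C', C' = 39 * C + 2 * cV + 2 := ⟨_, rfl⟩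
  have hC'0 : 0 < C' := by rw [hC']; positivity
  obtain ⟨R₀, hR₀, hR₀t⟩ := htight (κ / C') (by positivity)
  obtain ⟨R, hRdef⟩ : ∃ R, R = max R₀ 1 := ⟨_, rfl⟩
  have hR1 : 1 ≤ R := by rw [hRdef]; exact le_max_right _ _
  have hRR : R₀ ≤ R := by rw [hRdef]; exact le_max_left _ _
  obtain ⟨χ, hχ, hχc, hχ01, hχ1, hwb, hw'b, hD'b, hw'in, hD'in⟩ := hweight R hR1
  have hvir' := virial_identity hχ hχc hV hv hw hvt hwt
  have hxV : ∀ x, ∑ j, wa χ j x * fderiv ℝ V x (eb j) = χ x * xdV V x := by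
    intro x
    have hx : x = ∑ k, x k • eb k := by
      ext i; fin_cases i <;> simp [Fin.sum_univ_three, eb]
    have : xdV V x = ∑ k, x k * fderiv ℝ V x (eb k) := by
      unfold xdV
      exact (congrArg (fderiv ℝ V x) hx).trans (by simp only [map_sum, map_smul, smul_eq_mul])
    rw [this, Finset.mul_sum]
    exact Finset.sum_congr rfl fun k _ => by unfold wa; ring
  let T : Set R3 := {x | R₀ ≤ ‖x‖}
  have hT : MeasurableSet T := (isClosed_le continuous_const continuous_norm).measurableSet
  let g : ℝ → R3 → ℝ := fun t x => ‖u t x‖ ^ 2 + ‖fderiv ℝ (u t) x‖ ^ 2 + ‖u t x‖ ^ 4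
  have hg0 : ∀ t x, 0 ≤ g t x := fun t x => by positivity
  have ig : ∀ t, Integrable (g t) := fun t => ((i2 t).add (id2 t)).add (i4 t)
  have hpt : ∀ t x, PhiF χ V v w t x ≤ (-2 * ‖fderiv ℝ (u t) x‖ ^ 2 + 3 / 2 * ‖u t x‖ ^ 4
      + xdV V x * ‖u t x‖ ^ 2) + C' * T.indicator (g t) x := by
    intro t x
    have hx1 := abs_le.1 (hcV x)
    by_cases hx : ‖x‖ < R
    · have hnn : 0 ≤ C' * T.indicator (g t) x :=
        mul_nonneg hC'0.le (Set.indicator_nonneg (fun x _ => hg0 t x) x)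
      have hF := frob_upper (fderiv ℝ (u t) x)
      have := Phi_in (p := fun k => dd (0, eb k) v (t, x)) (q := fun k => dd (0, eb k) w (t, x))
        (v := v (t, x)) (w := w (t, x)) (hw'in x hx) (hD'in x hx) (hxV x)
      unfold PhiF
      rw [this, hn2, hχ1 x hx]
      simp only [hpq]
      nlinarith
    · have hxT : x ∈ T := hRR.trans (not_lt.1 hx)
      rw [Set.indicator_of_mem hxT]
      have hχx : |χ x * xdV V x| ≤ cV := by
        rw [abs_mul, abs_of_nonneg (hχ01 x).1]
        calc χ x * |xdV V x| ≤ 1 * cV :=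
              mul_le_mul (hχ01 x).2 (hcV x) (abs_nonneg _) zero_le_one
          _ = cV := one_mul _
      have := Phi_out (a := fun k => wa χ k x) (V' := fun j => fderiv ℝ V x (eb j)) (c := cV)
        hC (norm_nonneg _) (norm_nonneg _)
        (fun k j => hw'b k j x) (fun j => hD'b j x) (by rw [hxV]; exact hχx)
        (hpn t x) (hqn t x) (hvn t x) (hwn t x) (hn2 t x)
      refine le_trans this ?_
      have k1 : -cV * ‖u t x‖ ^ 2 ≤ xdV V x * ‖u t x‖ ^ 2 := by
        gcongr; exact hx1.1
      simp only [g]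
      rw [hC']
      have z2 : 0 ≤ ‖u t x‖ ^ 2 := by positivity
      have z4 : 0 ≤ ‖u t x‖ ^ 4 := by positivity
      have zd : 0 ≤ ‖fderiv ℝ (u t) x‖ ^ 2 := by positivity
      have y1 := mul_nonneg hC z2
      have y2 := mul_nonneg hC z4
      have y3 := mul_nonneg hC zd
      have y4 := mul_nonneg hcV0 z2
      have y5 := mul_nonneg hcV0 z4
      have y6 := mul_nonneg hcV0 zd
      nlinarith
  have hder : ∀ t, ∫ x, PhiF χ V v w t x ≤ -κ := by
    intro t
    have ia : Integrable (fun x => -2 * ‖fderiv ℝ (u t) x‖ ^ 2) := (id2 t).const_mul _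
    have ib : Integrable (fun x => 3 / 2 * ‖u t x‖ ^ 4) := (i4 t).const_mul _
    have iT : Integrable (fun x => C' * T.indicator (g t) x) :=
      ((ig t).indicator hT).const_mul _
    have iab : Integrable (fun x => -2 * ‖fderiv ℝ (u t) x‖ ^ 2 + 3 / 2 * ‖u t x‖ ^ 4) := ia.add ib
    have iabV : Integrable (fun x => -2 * ‖fderiv ℝ (u t) x‖ ^ 2 + 3 / 2 * ‖u t x‖ ^ 4
        + xdV V x * ‖u t x‖ ^ 2) := iab.add (iV t)
    have h1 := integral_mono (hvir' t).1 (((ia.add ib).add (iV t)).add iT) (hpt t)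
    have h2 : ∫ x, ((-2 * ‖fderiv ℝ (u t) x‖ ^ 2 + 3 / 2 * ‖u t x‖ ^ 4
      + xdV V x * ‖u t x‖ ^ 2) + C' * T.indicator (g t) x) = -2 * K2 V (u t)
      + C' * ∫ x in T, g t x := by
      rw [integral_add iabV iT, integral_add iab (iV t),
        integral_add ia ib, integral_const_mul, integral_const_mul, integral_const_mul,
        integral_indicator hT]
      unfold K2 H0 Gfun
      ring
    have h3 : ∫ x in T, g t x ≤ κ / C' := hR₀t t
    have h4 : C' * ∫ x in T, g t x ≤ κ := by
      calc C' * ∫ x in T, g t x ≤ C' * (κ / C') := by gcongr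
        _ = κ := by field_simp
    have h5 := hvir t
    have h6 : ∫ x, PhiF χ V v w t x ≤ -2 * K2 V (u t) + C' * ∫ x in T, g t x := by
      rw [← h2]; exact h1
    linarith
  -- boundedness of the localized momentum
  have hbd : ∀ t, |∫ x, mm χ v w (t, x)| ≤ 6 * C * R * B := by
    intro t
    have h0 : ∀ x, ‖mm χ v w (t, x)‖ ≤ 6 * C * R * (‖u t x‖ ^ 2 + ‖fderiv ℝ (u t) x‖ ^ 2) := by
      intro x
      have hCR : 0 ≤ C * R := by positivity
      have hk : ∀ k, |wa χ k x * (v (t, x) * dd (0, eb k) w (t, x)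
          - w (t, x) * dd (0, eb k) v (t, x))|
          ≤ C * R * (2 * (‖u t x‖ ^ 2 + ‖fderiv ℝ (u t) x‖ ^ 2)) := by
        intro k
        rw [abs_mul]
        refine mul_le_mul (hwb k x) ?_ (abs_nonneg _) hCR
        refine (abs_sub _ _).trans ?_
        rw [abs_mul, abs_mul]
        have h1 := mul_le_mul (hvn t x) (hqn t x k) (abs_nonneg _) (norm_nonneg _)
        have h2 := mul_le_mul (hwn t x) (hpn t x k) (abs_nonneg _) (norm_nonneg _)
        nlinarith [sq_nonneg (‖u t x‖ - ‖fderiv ℝ (u t) x‖), sq_nonneg ‖u t x‖,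
          sq_nonneg ‖fderiv ℝ (u t) x‖]
      unfold mm
      rw [Real.norm_eq_abs]
      refine (Finset.abs_sum_le_sum_abs _ _).trans ((Finset.sum_le_sum fun k _ => hk k).trans ?_)
      simp only [Fin.sum_univ_three]
      apply le_of_eq; ring
    have h1 := norm_integral_le_of_norm_le (((i2 t).add (id2 t)).const_mul (6 * C * R))
      (Filter.Eventually.of_forall h0)
    rw [Real.norm_eq_abs] at h1
    refine h1.trans ?_
    simp only [Pi.add_apply]
    rw [integral_const_mul]
    exact mul_le_mul_of_nonneg_left (hB t) (by positivity)
  -- conclusion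
  let M : ℝ → ℝ := fun t => ∫ x, mm χ v w (t, x)
  have hM : ∀ t, HasDerivAt M (∫ x, PhiF χ V v w t x) t := fun t => (hvir' t).2
  have hQ : 0 ≤ 6 * C * R * B := (abs_nonneg _).trans (hbd 0)
  obtain ⟨τ, hτ⟩ : ∃ τ, τ = (2 * (6 * C * R * B) + 1) / κ := ⟨_, rfl⟩
  have hτ0 : 0 ≤ τ := by rw [hτ]; positivity
  have hmv := image_sub_le_mul_sub_of_deriv_le (f := M) (fun t => (hM t).differentiableAt)
    (C := -κ) (fun t => by rw [(hM t).deriv]; exact hder t) hτ0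
  have hκτ : κ * τ = 2 * (6 * C * R * B) + 1 := by rw [hτ]; field_simp
  have a1 := abs_le.1 (hbd τ)
  have a2 := abs_le.1 (hbd 0)
  change (∫ x, mm χ v w (τ, x)) - (∫ x, mm χ v w (0, x)) ≤ _ at hmv
  linarith [a1.1, a2.2]

end
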